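/- (Seidenberg) Let n and d be positive integers. Then there exists a constant C = C(n,d) with the following property: for every algebraically closed field F and every ideal I of the polynomial ring F[X₁, …, X_n] generated by polynomials of total degree ≤ d, (i) the radical √I is generated by polynomials of total degree ≤ C, (ii) the set of minimal primes over I has cardinality at most C, and (iii) every minimal prime over I is generated by polynomials of total degree ≤ C. -/

import Mathlib

universe u

namespace Seid

open MvPolynomial

/-- Contraction of an ideal to polynomials with coefficients in a subring. -/
noncomputable def idA {F : Type u} [Field F] {σ : Type} (A : Subring F)
    (I : Ideal (MvPolynomial σ F)) : Ideal (MvPolynomial σ A) :=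
  I.comap (MvPolynomial.map A.subtype)

/-- Specialization of an ideal along `φ`. -/
noncomputable def sp {F E : Type u} [Field F] [Field E] {σ : Type} (A : Subring F) (φ : A →+* E)
    (I : Ideal (MvPolynomial σ F)) : Ideal (MvPolynomial σ E) :=
  (idA A I).map (MvPolynomial.map φ)

section basic

variable {F E : Type u} [Field F] [Field E] {σ : Type}

lemma mem_idA {A : Subring F} {I : Ideal (MvPolynomial σ F)} {f : MvPolynomial σ A} :
    f ∈ idA A I ↔ MvPolynomial.map A.subtype f ∈ I := Iff.rfl

lemma map_mem_sp {A : Subring F} (φ : A →+* E) {I : Ideal (MvPolynomial σ F)}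
    {f : MvPolynomial σ A} (h : MvPolynomial.map A.subtype f ∈ I) :
    MvPolynomial.map φ f ∈ sp A φ I :=
  Ideal.mem_map_of_mem _ (mem_idA.2 h)

lemma sp_mono {A : Subring F} (φ : A →+* E) {I J : Ideal (MvPolynomial σ F)} (h : I ≤ J) :
    sp A φ I ≤ sp A φ J :=
  Ideal.map_mono (Ideal.comap_mono h)

lemma sp_mul_le {A : Subring F} (φ : A →+* E) (I J : Ideal (MvPolynomial σ F)) :
    sp A φ I * sp A φ J ≤ sp A φ (I * J) := by
  unfold sp
  rw [← Ideal.map_mul]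
  apply Ideal.map_mono
  rw [Ideal.mul_le]
  intro r hr s hs
  rw [mem_idA] at *
  rw [map_mul]
  exact Ideal.mul_mem_mul hr hs

lemma sp_top {A : Subring F} (φ : A →+* E) :
    sp A φ (⊤ : Ideal (MvPolynomial σ F)) = ⊤ := by
  unfold sp idA
  rw [Ideal.comap_top, Ideal.map_top]

lemma sp_pow_le {A : Subring F} (φ : A →+* E) (I : Ideal (MvPolynomial σ F)) (k : ℕ) :
    (sp A φ I) ^ k ≤ sp A φ (I ^ k) := by
  induction k with
  | zero => simp [sp_top, Ideal.one_eq_top]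
  | succ k ih =>
    rw [pow_succ, pow_succ]
    exact (Ideal.mul_mono_left ih).trans (sp_mul_le φ _ _)

lemma exists_lift {A : Subring F} {f : MvPolynomial σ F} (h : (f.coeffs : Set F) ⊆ A) :
    ∃ f' : MvPolynomial σ A, MvPolynomial.map A.subtype f' = f := by
  have := (mem_range_map_iff_coeffs_subset (f := A.subtype) (x := f)).2 (by
    intro x hx; exact ⟨⟨x, h hx⟩, rfl⟩)
  exact this

lemma map_subtype_inj (A : Subring F) :
    Function.Injective (MvPolynomial.map (σ := σ) A.subtype) :=
  MvPolynomial.map_injective _ Subtype.val_injective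

/-- Finite Groebner basis. -/
lemma exists_groebner [Finite σ] (m : MonomialOrder σ) (I : Ideal (MvPolynomial σ F)) :
    ∃ G : Finset (MvPolynomial σ F), (∀ g ∈ G, g ∈ I ∧ m.leadingCoeff g = 1) ∧
      ∀ f ∈ I, f ≠ 0 → ∃ g ∈ G, m.degree g ≤ m.degree f := by
  classical
  let D : Set (σ →₀ ℕ) := {a | ∃ f ∈ I, f ≠ 0 ∧ m.degree f = a}
  have hfin : {a | Minimal (· ∈ D) a}.Finite :=
    (WellQuasiOrderedLE.finite_of_isAntichain (setOfPred_minimal_antichain _))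
  have hch : ∀ a : (σ →₀ ℕ), ∃ g : MvPolynomial σ F, a ∈ D →
      g ∈ I ∧ m.leadingCoeff g = 1 ∧ m.degree g = a := by
    intro a
    by_cases ha : a ∈ D
    · obtain ⟨f, hf, hf0, hfa⟩ := ha
      have hl : m.leadingCoeff f ≠ 0 := by simpa using hf0
      refine ⟨C (m.leadingCoeff f)⁻¹ * f, fun _ => ⟨Ideal.mul_mem_left _ _ hf, ?_, ?_⟩⟩
      · rw [MonomialOrder.leadingCoeff_mul]
        simp [hl]
      · rw [MonomialOrder.degree_mul (by simpa using hf0) hf0]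
        simp [hfa]
    · exact ⟨0, fun h => absurd h ha⟩
  choose g hg using hch
  refine ⟨hfin.toFinset.image g, ?_, ?_⟩
  · intro x hx
    simp only [Finset.mem_image, Set.Finite.mem_toFinset, Set.mem_ofPred_eq] at hx
    obtain ⟨a, ha, rfl⟩ := hx
    exact ⟨(hg a ha.1).1, (hg a ha.1).2.1⟩
  · intro f hf hf0
    obtain ⟨b, hb, hbm⟩ := exists_minimal_le_of_wellFoundedLT (· ∈ D) (m.degree f) ⟨f, hf, hf0, rfl⟩
    refine ⟨g b, Finset.mem_image_of_mem _ (by simpa using hbm), ?_⟩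
    rw [(hg b hbm.1).2.2]; exact hb

lemma degree_map_subtype (m : MonomialOrder σ) (A : Subring F) (f : MvPolynomial σ A) :
    m.degree (MvPolynomial.map A.subtype f) = m.degree f := by
  unfold MonomialOrder.degree
  rw [support_map_of_injective _ Subtype.val_injective]

lemma lin_mem {R : Type u} [CommRing R] (N : Submodule R (MvPolynomial σ R))
    (L : MvPolynomial σ R →ₗ[R] MvPolynomial σ R)
    (h : ∀ a, L (monomial a 1) ∈ N) (f : MvPolynomial σ R) : L f ∈ N := by
  induction f using MvPolynomial.induction_on' with
  | monomial a b =>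
    have : (monomial a b : MvPolynomial σ R) = b • monomial a 1 := by
      rw [smul_monomial, smul_eq_mul, mul_one]
    rw [this, map_smul]; exact N.smul_mem _ (h _)
  | add p q hp hq => rw [map_add]; exact N.add_mem hp hq

lemma exists_free [Finite σ] (I : Ideal (MvPolynomial σ F)) :
    ∃ G : Finset (MvPolynomial σ F), (∀ g ∈ G, g ∈ I) ∧
      ∀ A : Subring F, (∀ g ∈ G, (g.coeffs : Set F) ⊆ A) →
        idA A I = Ideal.span (MvPolynomial.map A.subtype ⁻¹' G) ∧
        ∃ ρ : MvPolynomial σ A →ₗ[A] MvPolynomial σ A,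
          (∀ f, f - ρ f ∈ idA A I) ∧ ∀ f ∈ idA A I, ρ f = 0 := by
  classical
  let _ : LinearOrder σ := WellOrderingRel.isWellOrder.linearOrder
  let m : MonomialOrder σ := MonomialOrder.lex
  obtain ⟨G, hG, hGI⟩ := exists_groebner m I
  refine ⟨G, fun g hg => (hG g hg).1, fun A hA => ?_⟩
  let B : Set (MvPolynomial σ A) := MvPolynomial.map A.subtype ⁻¹' G
  have hB : ∀ b ∈ B, IsUnit (m.leadingCoeff b) := by
    intro b hb
    have h1 := (hG _ hb).2
    have : m.leadingCoeff b = 1 := by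
      unfold MonomialOrder.leadingCoeff at h1 ⊢
      rw [degree_map_subtype, coeff_map] at h1
      exact Subtype.ext h1
    rw [this]; exact isUnit_one
  have hBI : ∀ b ∈ B, b ∈ idA A I := fun b hb => mem_idA.2 (hG _ hb).1
  have hstd : ∀ r ∈ idA A I, (∀ c ∈ r.support, ∀ b ∈ B, ¬ (m.degree b ≤ c)) → r = 0 := by
    intro r hr hc
    by_contra hr0
    have h1 : MvPolynomial.map A.subtype r ≠ 0 := by
      intro h; apply hr0; apply map_subtype_inj A; simpa using h
    obtain ⟨g, hg, hle⟩ := hGI _ (mem_idA.1 hr) h1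
    obtain ⟨g', rfl⟩ := exists_lift (hA g hg)
    rw [degree_map_subtype, degree_map_subtype] at hle
    exact hc _ (m.degree_mem_support hr0) g' hg hle
  have hdiv : ∀ f : MvPolynomial σ A, ∃ r : MvPolynomial σ A, f - r ∈ Ideal.span B ∧
      (∀ c ∈ r.support, ∀ b ∈ B, ¬ (m.degree b ≤ c)) := by
    intro f
    obtain ⟨g, r, h1, -, h3⟩ := MonomialOrder.div_set (m := m) hB f
    refine ⟨r, ?_, h3⟩
    rw [h1, add_sub_cancel_right, Finsupp.linearCombination_apply]
    exact Ideal.sum_mem _ fun b _ => Ideal.mul_mem_left _ _ (Ideal.subset_span b.2)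
  have hspan : Ideal.span B ≤ idA A I := Ideal.span_le.2 hBI
  refine ⟨le_antisymm ?_ hspan, ?_⟩
  · intro f hf
    obtain ⟨r, h1, h2⟩ := hdiv f
    have : r = 0 := hstd r (by
      have := (idA A I).sub_mem hf (hspan h1); simpa using this) h2
    simpa [this] using h1
  · choose r hr1 hr2 using hdiv
    let ρ : MvPolynomial σ A →ₗ[A] MvPolynomial σ A :=
      (basisMonomials σ A).constr A (fun a => r (monomial a 1))
    have hρ : ∀ a, ρ (monomial a 1) = r (monomial a 1) := by
      intro a
      have := (basisMonomials σ A).constr_basis A (fun a => r (monomial a 1)) a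
      simpa using this
    have h1 : ∀ f, f - ρ f ∈ idA A I := by
      intro f
      have := lin_mem ((idA A I).restrictScalars A) (LinearMap.id - ρ) (by
        intro a
        simp only [LinearMap.sub_apply, LinearMap.id_apply, hρ, Submodule.restrictScalars_mem]
        exact hspan (hr1 _)) f
      simpa using this
    refine ⟨ρ, h1, fun f hf => ?_⟩
    apply hstd
    · have := (idA A I).sub_mem hf (h1 f); simpa using this
    · have := lin_mem (restrictSupport A {c | ∀ b ∈ B, ¬ (m.degree b ≤ c)}) ρ (by
        intro a
        rw [hρ, mem_restrictSupport_iff]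
        exact fun c hc => hr2 _ c hc) f
      rw [mem_restrictSupport_iff] at this
      exact fun c hc => this hc

end basic

end Seid

namespace Seid

open MvPolynomial

section gen

variable {F E : Type u} [Field F] [Field E] {σ : Type}

lemma exists_gen [Finite σ] {κ : Type*} (f : κ → MvPolynomial σ F) :
    ∃ T : Finset F, ∀ A : Subring F, (T : Set F) ⊆ A →
      ∀ f' : κ → MvPolynomial σ A, (∀ k, MvPolynomial.map A.subtype (f' k) = f k) →
        idA A (Ideal.span (Set.range f)) = Ideal.span (Set.range f') := by
  classical
  obtain ⟨G, hG, hfree⟩ := exists_free (Ideal.span (Set.range f))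
  have hc : ∀ g : MvPolynomial σ F, ∃ c : κ →₀ MvPolynomial σ F,
      g ∈ G → (c.sum fun k a => a * f k) = g := by
    intro g
    by_cases hg : g ∈ G
    · obtain ⟨c, hc⟩ := (Finsupp.mem_ideal_span_range_iff_exists_finsupp).1 (hG g hg)
      exact ⟨c, fun _ => hc⟩
    · exact ⟨0, fun h => absurd h hg⟩
  choose c hc using hc
  refine ⟨G.biUnion (fun g => g.coeffs ∪ (c g).support.biUnion (fun k => (c g k).coeffs)), ?_⟩
  intro A hA f' hf'
  have hA1 : ∀ g ∈ G, (g.coeffs : Set F) ⊆ A := by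
    intro g hg x hx
    apply hA
    simp only [Finset.coe_biUnion, Set.mem_iUnion]
    exact ⟨g, hg, by simp [Finset.mem_coe.1 hx]⟩
  have hA2 : ∀ g ∈ G, ∀ k, ((c g k).coeffs : Set F) ⊆ A := by
    intro g hg k x hx
    by_cases hk : k ∈ (c g).support
    · apply hA
      simp only [Finset.coe_biUnion, Set.mem_iUnion]
      refine ⟨g, hg, ?_⟩
      rw [Finset.mem_coe, Finset.mem_union]
      right
      rw [Finset.mem_biUnion]
      exact ⟨k, hk, hx⟩
    · rw [Finsupp.notMem_support_iff.1 hk] at hx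
      simp at hx
  apply le_antisymm
  · rw [(hfree A hA1).1, Ideal.span_le]
    intro g' hg'
    have hg : MvPolynomial.map A.subtype g' ∈ G := hg'
    set g := MvPolynomial.map A.subtype g' with hgdef
    choose d hd using fun k => exists_lift (hA2 g hg k)
    have : g' = ∑ k ∈ (c g).support, d k * f' k := by
      apply map_subtype_inj A
      rw [← hgdef, map_sum]
      refine (hc g hg).symm.trans ?_
      refine Finset.sum_congr rfl fun k _ => ?_
      rw [map_mul, hd, hf']
    rw [this]
    exact Ideal.sum_mem _ fun k _ => Ideal.mul_mem_left _ _ (Ideal.subset_span ⟨k, rfl⟩)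
  · rw [Ideal.span_le]
    rintro _ ⟨k, rfl⟩
    rw [SetLike.mem_coe, mem_idA, hf']
    exact Ideal.subset_span ⟨k, rfl⟩

lemma sp_span_eq {κ : Type*} {f : κ → MvPolynomial σ F} {A : Subring F}
    {f' : κ → MvPolynomial σ A}
    (h : idA A (Ideal.span (Set.range f)) = Ideal.span (Set.range f')) (φ : A →+* E) :
    sp A φ (Ideal.span (Set.range f)) =
      Ideal.span (Set.range fun k => MvPolynomial.map φ (f' k)) := by
  unfold sp
  rw [h, Ideal.map_span, ← Set.range_comp]
  rfl

/-- coefficients of a finite family -/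
lemma exists_coeffs {κ : Type*} [Finite κ] (f : κ → MvPolynomial σ F) :
    ∃ T : Finset F, ∀ A : Subring F, (T : Set F) ⊆ A →
      ∀ k, ∃ f' : MvPolynomial σ A, MvPolynomial.map A.subtype f' = f k := by
  classical
  cases nonempty_fintype κ
  refine ⟨Finset.univ.biUnion fun k => (f k).coeffs, fun A hA k => exists_lift ?_⟩
  intro x hx
  apply hA
  simp only [Finset.coe_biUnion, Set.mem_iUnion]
  exact ⟨k, Finset.mem_univ _, hx⟩

lemma exists_coeffs_one (f : MvPolynomial σ F) :
    ∃ T : Finset F, ∀ A : Subring F, (T : Set F) ⊆ A →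
      ∃ f' : MvPolynomial σ A, MvPolynomial.map A.subtype f' = f :=
  ⟨f.coeffs, fun _ hA => exists_lift hA⟩

lemma exists_fin_gen [Finite σ] (I : Ideal (MvPolynomial σ F)) :
    ∃ (k : ℕ) (f : Fin k → MvPolynomial σ F), Ideal.span (Set.range f) = I := by
  obtain ⟨k, f, hf⟩ := Submodule.fg_iff_exists_fin_generating_family.1
    ((isNoetherianRing_iff_ideal_fg _).1 inferInstance I)
  exact ⟨k, f, hf⟩

lemma exists_degree_bound [Finite σ] (I : Ideal (MvPolynomial σ F)) :
    ∃ (T : Finset F) (D : ℕ), ∀ A : Subring F, (T : Set F) ⊆ A →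
      ∀ (E : Type u) [Field E] (φ : A →+* E), ∃ S : Set (MvPolynomial σ E),
        (∀ f ∈ S, f.totalDegree ≤ D) ∧ Ideal.span S = sp A φ I := by
  classical
  obtain ⟨k, f, rfl⟩ := exists_fin_gen I
  obtain ⟨T1, h1⟩ := exists_gen f
  obtain ⟨T2, h2⟩ := exists_coeffs f
  refine ⟨T1 ∪ T2, Finset.univ.sup fun k => (f k).totalDegree, fun A hA E _ φ => ?_⟩
  rw [Finset.coe_union, Set.union_subset_iff] at hA
  choose f' hf' using h2 A hA.2
  refine ⟨_, ?_, (sp_span_eq (h1 A hA.1 f' hf') φ).symm⟩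
  rintro _ ⟨k, rfl⟩
  refine le_trans (Finset.sup_mono (support_map_subset _ _)) ?_
  change (f' k).totalDegree ≤ _
  have : (f' k).totalDegree = (f k).totalDegree := by
    rw [← hf' k]
    unfold totalDegree
    rw [support_map_of_injective _ Subtype.val_injective]
  rw [this]
  exact Finset.le_sup (f := fun k => (f k).totalDegree) (Finset.mem_univ k)

lemma exists_sup [Finite σ] (I J : Ideal (MvPolynomial σ F)) :
    ∃ T : Finset F, ∀ A : Subring F, (T : Set F) ⊆ A → idA A (I ⊔ J) ≤ idA A I ⊔ idA A J := by
  classical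
  obtain ⟨k, f, rfl⟩ := exists_fin_gen I
  obtain ⟨l, g, rfl⟩ := exists_fin_gen J
  obtain ⟨T1, h1⟩ := exists_gen (Sum.elim f g)
  obtain ⟨T2, h2⟩ := exists_coeffs (Sum.elim f g)
  refine ⟨T1 ∪ T2, fun A hA => ?_⟩
  rw [Finset.coe_union, Set.union_subset_iff] at hA
  choose f' hf' using h2 A hA.2
  have h3 := h1 A hA.1 f' hf'
  rw [Set.Sum.elim_range, Ideal.span_union] at h3
  rw [h3, Ideal.span_le]
  rintro _ ⟨k | l, rfl⟩
  · apply Ideal.mem_sup_left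
    rw [mem_idA, hf']
    exact Ideal.subset_span ⟨k, rfl⟩
  · apply Ideal.mem_sup_right
    rw [mem_idA, hf']
    exact Ideal.subset_span ⟨l, rfl⟩

/-- extension of scalars of a linear endomorphism along `φ`. -/
lemma exists_ext {R : Type u} [CommRing R] (φ : R →+* E)
    (L : MvPolynomial σ R →ₗ[R] MvPolynomial σ R) :
    ∃ L' : MvPolynomial σ E →ₗ[E] MvPolynomial σ E,
      ∀ f, L' (MvPolynomial.map φ f) = MvPolynomial.map φ (L f) := by
  let L' : MvPolynomial σ E →ₗ[E] MvPolynomial σ E :=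
      (basisMonomials σ E).constr E (fun a => MvPolynomial.map φ (L (monomial a 1)))
  have hL' : ∀ a, L' (monomial a 1) = MvPolynomial.map φ (L (monomial a 1)) := by
    intro a
    have := (basisMonomials σ E).constr_basis E
      (fun a => MvPolynomial.map φ (L (monomial a 1))) a
    simpa using this
  refine ⟨L', fun f => ?_⟩
  induction f using MvPolynomial.induction_on' with
  | monomial a b =>
    have h1 : (monomial a b : MvPolynomial σ R) = b • monomial a 1 := by
      rw [smul_monomial, smul_eq_mul, mul_one]
    have h2 : (monomial a (φ b) : MvPolynomial σ E) = φ b • monomial a 1 := by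
      rw [smul_monomial, smul_eq_mul, mul_one]
    rw [map_monomial, h2, map_smul, hL', h1, map_smul, smul_eq_C_mul, smul_eq_C_mul, map_mul,
      map_C]
  | add p q hp hq => simp only [map_add, hp, hq]

/-- An `E`-linear map sending `φ(f)`, `f ∈ I_A`, into `N` sends `sp I` into `N`. -/
lemma lin_sp {A : Subring F} (φ : A →+* E) (I : Ideal (MvPolynomial σ F))
    (L : MvPolynomial σ E →ₗ[E] MvPolynomial σ E) (N : Submodule E (MvPolynomial σ E))
    (h : ∀ f ∈ idA A I, L (MvPolynomial.map φ f) ∈ N) : ∀ f ∈ sp A φ I, L f ∈ N := by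
  intro f hf
  unfold sp Ideal.map at hf
  refine Submodule.span_induction (p := fun x _ => ∀ y, L (y * x) ∈ N)
    ?_ ?_ ?_ ?_ hf 1 |> fun h => by simpa using h
  · rintro _ ⟨g, hg, rfl⟩ y
    induction y using MvPolynomial.induction_on' with
    | monomial a b =>
      have h2 : (monomial a b : MvPolynomial σ E) = b • MvPolynomial.map φ (monomial a 1) := by
        rw [map_monomial, smul_monomial, smul_eq_mul, map_one, mul_one]
      rw [h2, smul_mul_assoc, map_smul, ← map_mul]
      exact N.smul_mem _ (h _ (Ideal.mul_mem_left _ _ hg))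
    | add p q hp hq => rw [add_mul, map_add]; exact N.add_mem hp hq
  · intro y; simp
  · intro x z _ _ hx hz y
    rw [mul_add, map_add]; exact N.add_mem (hx y) (hz y)
  · intro a x _ hx y
    rw [smul_eq_mul, ← mul_assoc]; exact hx _

lemma exists_inf [Finite σ] (I J : Ideal (MvPolynomial σ F)) :
    ∃ T : Finset F, ∀ A : Subring F, (T : Set F) ⊆ A →
      ∀ (E : Type u) [Field E] (φ : A →+* E), sp A φ I ⊓ sp A φ J = sp A φ (I ⊓ J) := by
  classical
  obtain ⟨T1, hT1⟩ := exists_sup I J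
  obtain ⟨G, hG, hfree⟩ := exists_free (I ⊔ J)
  refine ⟨T1 ∪ G.biUnion coeffs, fun A hA E _ φ => ?_⟩
  rw [Finset.coe_union, Set.union_subset_iff] at hA
  have hsup : idA A (I ⊔ J) ≤ idA A I ⊔ idA A J := hT1 A hA.1
  obtain ⟨-, ρ, hρ1, hρ2⟩ := hfree A (by
    intro g hg x hx
    apply hA.2
    simp only [Finset.coe_biUnion, Set.mem_iUnion]
    exact ⟨g, hg, hx⟩)
  have hsup' : idA A I ⊔ idA A J ≤ idA A (I ⊔ J) :=
    sup_le (Ideal.comap_mono le_sup_left) (Ideal.comap_mono le_sup_right)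
  apply le_antisymm _ (le_inf (sp_mono φ inf_le_left) (sp_mono φ inf_le_right))
  have hdec : ∀ a : σ →₀ ℕ, ∃ i ∈ idA A I, ∃ j ∈ idA A J,
      i + j = monomial a (1 : A) - ρ (monomial a 1) :=
    fun a => Submodule.mem_sup.1 (hsup (hρ1 _))
  choose i hi j hj hij using hdec
  let Li : MvPolynomial σ A →ₗ[A] MvPolynomial σ A := (basisMonomials σ A).constr A i
  have hLi : ∀ a, Li (monomial a 1) = i a := by
    intro a
    have := (basisMonomials σ A).constr_basis A i a
    simpa using this
  have hi' : ∀ f, Li f ∈ idA A I := fun f =>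
    lin_mem ((idA A I).restrictScalars A) Li (fun a => by rw [hLi]; exact hi a) f
  let Lj : MvPolynomial σ A →ₗ[A] MvPolynomial σ A := LinearMap.id - ρ - Li
  have hj' : ∀ f, Lj f ∈ idA A J := fun f =>
    lin_mem ((idA A J).restrictScalars A) Lj (fun a => by
      have : Lj (monomial a 1) = j a := by
        simp only [Lj, LinearMap.sub_apply, LinearMap.id_apply, hLi, ← hij]
        ring
      rw [this]; exact hj a) f
  have hsum : ∀ f ∈ idA A (I ⊔ J), f = Li f + Lj f := by
    intro f hf
    simp [Lj, hρ2 f hf]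
  obtain ⟨Mi, hMi⟩ := exists_ext φ Li
  obtain ⟨Mj, hMj⟩ := exists_ext φ Lj
  have e1 : ∀ h ∈ sp A φ J, Mi h ∈ sp A φ (I ⊓ J) := by
    refine lin_sp φ J Mi ((sp A φ (I ⊓ J)).restrictScalars E) fun f hf => ?_
    rw [hMi]
    apply map_mem_sp
    have h2 : Li f = f - Lj f := by
      nth_rewrite 2 [hsum f (hsup' (Ideal.mem_sup_right hf))]
      ring
    exact ⟨hi' f, by
      rw [h2]; exact (idA A J).sub_mem hf (hj' f)⟩
  have e2 : ∀ h ∈ sp A φ I, Mj h ∈ sp A φ (I ⊓ J) := by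
    refine lin_sp φ I Mj ((sp A φ (I ⊓ J)).restrictScalars E) fun f hf => ?_
    rw [hMj]
    apply map_mem_sp
    have h2 : Lj f = f - Li f := by
      nth_rewrite 2 [hsum f (hsup' (Ideal.mem_sup_left hf))]
      ring
    exact ⟨by
      rw [h2]; exact (idA A I).sub_mem hf (hi' f), hj' f⟩
  have e3 : ∀ h ∈ sp A φ I, ((LinearMap.id : MvPolynomial σ E →ₗ[E] MvPolynomial σ E) - Mi - Mj) h ∈
      (⊥ : Submodule E (MvPolynomial σ E)) := by
    refine lin_sp φ I _ ⊥ fun f hf => ?_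
    simp only [LinearMap.sub_apply, LinearMap.id_apply, hMi, hMj, Submodule.mem_bot]
    nth_rewrite 1 [hsum f (hsup' (Ideal.mem_sup_left hf))]
    simp
  rintro h ⟨hI, hJ⟩
  have h3 := e3 h hI
  simp only [LinearMap.sub_apply, LinearMap.id_apply, Submodule.mem_bot] at h3
  have h4 : h = Mi h + Mj h := by linear_combination h3
  rw [h4]
  exact Ideal.add_mem _ (e1 h hJ) (e2 h hI)

/-- Saturation. -/
lemma exists_sat [Finite σ] (Q : Ideal (MvPolynomial σ F)) [hQ : Q.IsPrime]
    (s : MvPolynomial σ F) (hs : s ∉ Q) :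
    ∃ T : Finset F, ∀ A : Subring F, (T : Set F) ⊆ A →
      ∀ (E : Type u) [Field E] (φ : A →+* E) (s' : MvPolynomial σ A),
        MvPolynomial.map A.subtype s' = s →
        ∀ f, MvPolynomial.map φ s' * f ∈ sp A φ Q → f ∈ sp A φ Q := by
  classical
  have hs0 : s ≠ 0 := fun h => hs (h ▸ Q.zero_mem)
  obtain ⟨a, ha⟩ := MvPolynomial.ne_zero_iff.1 hs0
  obtain ⟨T1, h1⟩ := exists_inf Q (Ideal.span {s})
  obtain ⟨k, q, hq⟩ := exists_fin_gen Q
  obtain ⟨T2, h2⟩ := exists_gen (fun i => s * q i)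
  obtain ⟨T3, h3⟩ := exists_coeffs q
  refine ⟨T1 ∪ T2 ∪ T3 ∪ {(coeff a s)⁻¹}, fun A hA E _ φ s' hs' f hf => ?_⟩
  simp only [Finset.coe_union, Set.union_subset_iff, Finset.coe_singleton,
    Set.singleton_subset_iff] at hA
  obtain ⟨⟨⟨hA1, hA2⟩, hA3⟩, hA4⟩ := hA
  have hne : MvPolynomial.map φ s' ≠ 0 := by
    intro h0
    have e1 : coeff a s' * (⟨_, hA4⟩ : A) = 1 := by
      apply Subtype.ext
      have : ((coeff a s' : A) : F) = coeff a s := by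
        rw [← hs', coeff_map]; rfl
      simp only [MulMemClass.coe_mul, OneMemClass.coe_one, this]
      exact mul_inv_cancel₀ ha
    have e2 : φ (coeff a s') = 0 := by
      rw [← coeff_map, h0, coeff_zero]
    have := congrArg φ e1
    rw [map_mul, e2, zero_mul, map_one] at this
    exact zero_ne_one this
  choose q' hq' using h3 A hA3
  have hinf : Q ⊓ Ideal.span {s} = Ideal.span (Set.range fun i => s * q i) := by
    apply le_antisymm
    · rintro x ⟨hx1, hx2⟩
      obtain ⟨y, rfl⟩ := Ideal.mem_span_singleton.1 hx2
      have hy : y ∈ Q := (hQ.mem_or_mem hx1).resolve_left hs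
      rw [← hq] at hy
      obtain ⟨c, rfl⟩ := (Ideal.mem_span_range_iff_exists_fun).1 hy
      rw [Finset.mul_sum]
      refine Ideal.sum_mem _ fun i _ => ?_
      rw [mul_left_comm]
      exact Ideal.mul_mem_left _ _ (Ideal.subset_span ⟨i, rfl⟩)
    · rw [Ideal.span_le]
      rintro _ ⟨i, rfl⟩
      refine ⟨?_, ?_⟩
      · exact Ideal.mul_mem_left _ _ (hq ▸ Ideal.subset_span ⟨i, rfl⟩)
      · exact Ideal.mul_mem_right _ _ (Ideal.mem_span_singleton_self s)
  have hmem : MvPolynomial.map φ s' * f ∈ sp A φ (Q ⊓ Ideal.span {s}) := by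
    rw [← h1 A hA1 E φ]
    refine ⟨hf, Ideal.mul_mem_right _ _ (map_mem_sp φ ?_)⟩
    rw [hs']; exact Ideal.mem_span_singleton_self s
  rw [hinf, sp_span_eq (h2 A hA2 (fun i => s' * q' i) (by
    intro i; rw [map_mul, hs', hq'])) φ] at hmem
  obtain ⟨c, hc⟩ := (Ideal.mem_span_range_iff_exists_fun).1 hmem
  have : f = ∑ i, c i * MvPolynomial.map φ (q' i) := by
    apply mul_left_cancel₀ hne
    rw [← hc, Finset.mul_sum]
    refine Finset.sum_congr rfl fun i _ => ?_
    rw [map_mul]; ring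
  rw [this]
  refine Ideal.sum_mem _ fun i _ => Ideal.mul_mem_left _ _ (map_mem_sp φ ?_)
  rw [hq', ← hq]; exact Ideal.subset_span ⟨i, rfl⟩

end gen

end Seid

namespace Seid

open MvPolynomial

section irred

variable {ι : Type}

lemma nonunit_of_coeff {K : Type u} [Field K] {p : MvPolynomial ι K} {a : ι →₀ ℕ} (ha : a ≠ 0)
    (h : coeff a p ≠ 0) : ¬ IsUnit p := fun hu =>
  h ((MvPolynomial.isUnit_iff.1 hu).2 a ha).eq_zero

lemma coeff_of_nonunit {K : Type u} [Field K] {p : MvPolynomial ι K} (h0 : p ≠ 0)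
    (h : ¬ IsUnit p) : ∃ a, a ≠ 0 ∧ coeff a p ≠ 0 := by
  by_contra! hc
  apply h
  rw [MvPolynomial.isUnit_iff]
  refine ⟨?_, fun i hi => by rw [hc i hi]; exact IsNilpotent.zero⟩
  rw [isUnit_iff_ne_zero]
  intro h1
  apply h0
  ext a
  by_cases ha : a = 0
  · rw [ha, h1, coeff_zero]
  · rw [hc a ha, coeff_zero]

/-- The polynomial with given coefficients. -/
noncomputable def pol {R : Type u} [CommRing R] (M : Finset (ι →₀ ℕ)) (x : M → R) :
    MvPolynomial ι R := ∑ a : M, monomial (a : ι →₀ ℕ) (x a)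

lemma pol_map {R S : Type u} [CommRing R] [CommRing S] (ψ : R →+* S) (M : Finset (ι →₀ ℕ))
    (x : M → R) : MvPolynomial.map ψ (pol M x) = pol M (fun a => ψ (x a)) := by
  simp [pol, map_sum, map_monomial]

lemma coeff_pol {R : Type u} [CommRing R] (M : Finset (ι →₀ ℕ)) (x : M → R) (a : M) :
    coeff (a : ι →₀ ℕ) (pol M x) = x a := by
  classical
  rw [pol, coeff_sum, Finset.sum_eq_single a]
  · simp
  · intro b _ hb
    rw [coeff_monomial, if_neg]
    exact fun h => hb (Subtype.ext h)
  · simp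

lemma pol_coeff {R : Type u} [CommRing R] (M : Finset (ι →₀ ℕ)) (p : MvPolynomial ι R)
    (hp : p.support ⊆ M) : pol M (fun a => coeff (a : ι →₀ ℕ) p) = p := by
  classical
  conv_rhs => rw [p.as_sum]
  rw [pol, Finset.sum_coe_sort M (fun a => monomial a (coeff a p))]
  symm
  apply Finset.sum_subset hp
  intro a _ ha
  rw [notMem_support_iff.1 ha, map_zero]

/-- The system of equations expressing a factorization of `g`. -/
noncomputable def sys {R : Type u} [CommRing R] (M : Finset (ι →₀ ℕ)) (α β : M)
    (g : MvPolynomial ι R) : Option (ι →₀ ℕ) → MvPolynomial (M ⊕ M ⊕ Unit) R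
  | none => X (Sum.inl α) * X (Sum.inr (Sum.inl β)) * X (Sum.inr (Sum.inr ())) - 1
  | some c => coeff c (pol M (fun a => (X (Sum.inl a) : MvPolynomial (M ⊕ M ⊕ Unit) R)) *
      pol M (fun a => X (Sum.inr (Sum.inl a)))) - C (coeff c g)

lemma sys_map {R S : Type u} [CommRing R] [CommRing S] (ψ : R →+* S) (M : Finset (ι →₀ ℕ))
    (α β : M) (g : MvPolynomial ι R) (k) :
    MvPolynomial.map ψ (sys M α β g k) = sys M α β (MvPolynomial.map ψ g) k := by
  cases k with
  | none => simp [sys]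
  | some c =>
    simp only [sys, map_sub, map_C, coeff_map]
    rw [← coeff_map, map_mul, pol_map, pol_map]
    simp

lemma sys_eval {R : Type u} [CommRing R] (M : Finset (ι →₀ ℕ))
    (α β : M) (g : MvPolynomial ι R) (x : M ⊕ M ⊕ Unit → R) :
    (∀ k, eval x (sys M α β g k) = 0) ↔
      pol M (fun a => x (Sum.inl a)) * pol M (fun a => x (Sum.inr (Sum.inl a))) = g ∧
      x (Sum.inl α) * x (Sum.inr (Sum.inl β)) * x (Sum.inr (Sum.inr ())) = 1 := by
  have h1 : ∀ c, eval x (sys M α β g (some c)) =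
      coeff c (pol M (fun a => x (Sum.inl a)) * pol M (fun a => x (Sum.inr (Sum.inl a)))) -
        coeff c g := by
    intro c
    simp only [sys, map_sub, eval_C]
    rw [← coeff_map, map_mul, pol_map, pol_map]
    simp
  constructor
  · intro h
    refine ⟨?_, ?_⟩
    · ext c
      have := h (some c)
      rw [h1] at this
      exact sub_eq_zero.1 this
    · have := h none
      simp only [sys, map_sub, map_mul, eval_X, map_one] at this
      exact sub_eq_zero.1 this
  · rintro ⟨h2, h3⟩ (_ | c)
    · simp only [sys, map_sub, map_mul, eval_X, map_one, h3, sub_self]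
    · rw [h1, h2, sub_self]

lemma exists_irred {F : Type u} [Field F] [IsAlgClosed F] [Finite ι] (g : MvPolynomial ι F)
    (hg : Irreducible g) :
    ∃ T : Finset F, ∀ A : Subring F, (T : Set F) ⊆ A →
      ∀ (E : Type u) [Field E] (φ : A →+* E) (g' : MvPolynomial ι A),
        MvPolynomial.map A.subtype g' = g → Irreducible (MvPolynomial.map φ g') := by
  classical
  let M : Finset (ι →₀ ℕ) := (Finsupp.finite_of_degree_le (σ := ι) g.totalDegree).toFinset
  have hM : ∀ {K : Type u} [Field K] (p : MvPolynomial ι K), p.totalDegree ≤ g.totalDegree →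
      p.support ⊆ M := by
    intro K _ p hp a ha
    simp only [M, Set.Finite.mem_toFinset]
    exact (le_totalDegree ha).trans hp
  obtain ⟨γ, hγ0, hγ⟩ := coeff_of_nonunit hg.ne_zero hg.not_isUnit
  have key : ∀ p : M × M, ∃ T : Finset F, (p.1 : ι →₀ ℕ) ≠ 0 → (p.2 : ι →₀ ℕ) ≠ 0 →
      ∀ A : Subring F, (T : Set F) ⊆ A →
      ∀ (E : Type u) [Field E] (φ : A →+* E) (g' : MvPolynomial ι A),
        MvPolynomial.map A.subtype g' = g →
        ¬ ∃ x, ∀ k, eval x (sys M p.1 p.2 (MvPolynomial.map φ g') k) = 0 := by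
    rintro ⟨α, β⟩
    by_cases hα : (α : ι →₀ ℕ) = 0
    · exact ⟨∅, fun h => absurd hα h⟩
    by_cases hβ : (β : ι →₀ ℕ) = 0
    · exact ⟨∅, fun _ h => absurd hβ h⟩
    have htop : Ideal.span (Set.range (sys M α β g)) = ⊤ := by
      by_contra hne
      obtain ⟨m, hm, hle⟩ := Ideal.exists_le_maximal _ hne
      obtain ⟨x, hx⟩ := isMaximal_iff_eq_vanishingIdeal_singleton.1 hm
      have hz : ∀ k, eval x (sys M α β g k) = 0 := by
        intro k
        have : sys M α β g k ∈ m := hle (Ideal.subset_span ⟨k, rfl⟩)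
        rw [hx, mem_vanishingIdeal_singleton_iff] at this
        simpa [aeval_eq_eval] using this
      rw [sys_eval] at hz
      obtain ⟨h1, h2⟩ := hz
      rcases hg.isUnit_or_isUnit h1.symm with hu | hu
      · refine nonunit_of_coeff hα ?_ hu
        rw [coeff_pol]
        intro h0; rw [h0] at h2; simp at h2
      · refine nonunit_of_coeff hβ ?_ hu
        rw [coeff_pol]
        intro h0; rw [h0] at h2; simp at h2
    obtain ⟨T, hT⟩ := exists_gen (sys M α β g)
    refine ⟨T, fun _ _ A hA E _ φ g' hg' => ?_⟩
    rintro ⟨x, hx⟩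
    have h1 := sp_span_eq (hT A hA (sys M α β g') (fun k => by rw [sys_map, hg'])) φ
    rw [htop, sp_top] at h1
    have h2 : (Ideal.span (Set.range fun k => MvPolynomial.map φ (sys M α β g' k))) ≤
        RingHom.ker (eval x) := by
      rw [Ideal.span_le]
      rintro _ ⟨k, rfl⟩
      simp only [SetLike.mem_coe, RingHom.mem_ker]
      rw [sys_map]
      exact hx k
    rw [← h1] at h2
    have h3 := h2 (Submodule.mem_top : (1 : MvPolynomial _ E) ∈ _)
    rw [RingHom.mem_ker, map_one] at h3
    exact one_ne_zero h3
  choose T hT using key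
  refine ⟨(Finset.univ.biUnion T) ∪ {(coeff γ g)⁻¹}, fun A hA E _ φ g' hg' => ?_⟩
  simp only [Finset.coe_union, Set.union_subset_iff, Finset.coe_singleton,
    Set.singleton_subset_iff] at hA
  obtain ⟨hA1, hA4⟩ := hA
  have hne : coeff γ (MvPolynomial.map φ g') ≠ 0 := by
    intro h0
    have e1 : coeff γ g' * (⟨_, hA4⟩ : A) = 1 := by
      apply Subtype.ext
      have : ((coeff γ g' : A) : F) = coeff γ g := by
        rw [← hg', coeff_map]; rfl
      simp only [MulMemClass.coe_mul, OneMemClass.coe_one, this]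
      exact mul_inv_cancel₀ hγ
    have := congrArg φ e1
    rw [coeff_map] at h0
    rw [map_mul, h0, zero_mul, map_one] at this
    exact zero_ne_one this
  have hg0 : MvPolynomial.map φ g' ≠ 0 := by
    intro h; rw [h, coeff_zero] at hne; exact hne rfl
  have hdeg : (MvPolynomial.map φ g').totalDegree ≤ g.totalDegree := by
    refine le_trans (Finset.sup_mono (support_map_subset _ _)) ?_
    rw [← hg']
    unfold totalDegree
    rw [support_map_of_injective _ Subtype.val_injective]
  refine ⟨nonunit_of_coeff hγ0 hne, fun a b hab => ?_⟩
  by_contra! hu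
  have ha0 : a ≠ 0 := by rintro rfl; rw [zero_mul] at hab; exact hg0 hab
  have hb0 : b ≠ 0 := by rintro rfl; rw [mul_zero] at hab; exact hg0 hab
  have hd : a.totalDegree + b.totalDegree ≤ g.totalDegree := by
    rw [← totalDegree_mul_of_isDomain ha0 hb0, ← hab]; exact hdeg
  have hsa := hM a (by omega)
  have hsb := hM b (by omega)
  obtain ⟨α, hα, hα'⟩ := coeff_of_nonunit ha0 hu.1
  obtain ⟨β, hβ, hβ'⟩ := coeff_of_nonunit hb0 hu.2
  have hαM : α ∈ M := hsa (mem_support_iff.2 hα')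
  have hβM : β ∈ M := hsb (mem_support_iff.2 hβ')
  refine hT (⟨α, hαM⟩, ⟨β, hβM⟩) hα hβ A (subset_trans ?_ hA1) E φ g' hg'
    ⟨Sum.elim (fun c => coeff (c : ι →₀ ℕ) a)
      (Sum.elim (fun c => coeff (c : ι →₀ ℕ) b) (fun _ => (coeff α a * coeff β b)⁻¹)), ?_⟩
  · exact_mod_cast Finset.subset_biUnion_of_mem T (Finset.mem_univ _)
  · rw [sys_eval]
    simp only [Sum.elim_inl, Sum.elim_inr]
    rw [pol_coeff M a hsa, pol_coeff M b hsb]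
    exact ⟨hab.symm, mul_inv_cancel₀ (mul_ne_zero hα' hβ')⟩

end irred

end Seid

namespace Seid

open MvPolynomial

section hyper

universe v w

lemma exists_homog {A : Type v} [CommRing A] {σ ι : Type} (f : MvPolynomial σ A)
    (p : σ → MvPolynomial ι A) (s : MvPolynomial ι A) :
    ∃ (N : ℕ) (q : MvPolynomial ι A), ∀ (R : Type w) [CommRing R] (χ : MvPolynomial ι A →+* R)
      (x : σ → R), (∀ j, χ s * x j = χ (p j)) → χ q = χ s ^ N * eval₂ (χ.comp C) x f := by
  induction f using MvPolynomial.induction_on with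
  | C a => exact ⟨0, C a, fun R _ χ x _ => by simp⟩
  | add f g hf hg =>
    obtain ⟨N1, q1, h1⟩ := hf
    obtain ⟨N2, q2, h2⟩ := hg
    refine ⟨N1 + N2, s ^ N2 * q1 + s ^ N1 * q2, fun R _ χ x hx => ?_⟩
    rw [map_add, map_mul, map_mul, h1 R χ x hx, h2 R χ x hx, eval₂_add, map_pow, map_pow]
    ring
  | mul_X f j hf =>
    obtain ⟨N, q, h⟩ := hf
    refine ⟨N + 1, q * p j, fun R _ χ x hx => ?_⟩
    rw [map_mul, h R χ x hx, ← hx j, eval₂_mul, eval₂_X]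
    ring

lemma ker_poly {R : Type v} [CommRing R] [IsDomain R] [UniqueFactorizationMonoid R]
    {L : Type w} [Field L] [Algebra R L] (hinj : Function.Injective (algebraMap R L)) (α : L)
    (hα : RingHom.ker (Polynomial.aeval α : Polynomial R →ₐ[R] L) ≠ ⊥) :
    ∃ g : Polynomial R, Irreducible g ∧
      RingHom.ker (Polynomial.aeval α : Polynomial R →ₐ[R] L) = Ideal.span {g} := by
  classical
  obtain ⟨g, hg, hgp⟩ := Ideal.IsPrime.exists_mem_prime_of_ne_bot (RingHom.ker_isPrime _) hα
  refine ⟨g, hgp.irreducible, le_antisymm ?_ ?_⟩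
  swap
  · rw [Ideal.span_le, Set.singleton_subset_iff]; exact hg
  have hC : ∀ r : R, r ≠ 0 → Polynomial.C r ∉
      RingHom.ker (Polynomial.aeval α : Polynomial R →ₐ[R] L) := by
    intro r hr h
    rw [RingHom.mem_ker, Polynomial.aeval_C] at h
    exact hr (hinj (by rw [h, map_zero]))
  have hdeg : g.natDegree ≠ 0 := by
    intro h
    rw [Polynomial.eq_C_of_natDegree_eq_zero h] at hg
    refine hC _ ?_ hg
    intro h0
    apply hgp.ne_zero
    rw [Polynomial.eq_C_of_natDegree_eq_zero h, h0, Polynomial.C_0]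
  let K := FractionRing R
  have : FaithfulSMul R L := (faithfulSMul_iff_algebraMap_injective R L).2 hinj
  let : Algebra K L := FractionRing.liftAlgebra R L
  have : IsScalarTower R K L := FractionRing.isScalarTower_liftAlgebra R L
  obtain ⟨_⟩ : Nonempty (GCDMonoid R) := ⟨UniqueFactorizationMonoid.toGCDMonoid R⟩
  have hgirr : Irreducible (g.map (algebraMap R K)) :=
    ((hgp.irreducible.isPrimitive hdeg).irreducible_iff_irreducible_map_fraction_map).1
      hgp.irreducible
  have hroot : ∀ q : Polynomial R, q ∈ RingHom.ker (Polynomial.aeval α : Polynomial R →ₐ[R] L) →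
      minpoly K α ∣ q.map (algebraMap R K) := by
    intro q hq
    apply minpoly.dvd
    rw [Polynomial.aeval_map_algebraMap]
    exact hq
  have hassoc : g.map (algebraMap R K) ∣ minpoly K α := by
    refine (Irreducible.dvd_comm ?_ hgirr).1 (hroot g hg)
    apply minpoly.irreducible
    apply IsAlgebraic.isIntegral
    refine ⟨g.map (algebraMap R K), hgirr.ne_zero, ?_⟩
    rw [Polynomial.aeval_map_algebraMap]
    exact hg
  intro q hq
  obtain ⟨h, hh⟩ := hassoc.trans (hroot q hq)
  obtain ⟨b, hbM, hb⟩ := IsLocalization.integerNormalization_spec (nonZeroDivisors R) h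
  have hb0 : (b : R) ≠ 0 := nonZeroDivisors.ne_zero hbM
  have hdvd : g ∣ Polynomial.C (b : R) * q := by
    refine ⟨IsLocalization.integerNormalization (nonZeroDivisors R) h, ?_⟩
    apply Polynomial.map_injective (algebraMap R K) (IsFractionRing.injective R K)
    rw [Polynomial.map_mul, Polynomial.map_mul, hb, hh, Polynomial.map_C,
      mul_left_comm, Algebra.smul_def]
    rfl
  rw [Ideal.mem_span_singleton]
  rcases hgp.dvd_or_dvd hdvd with h1 | h1
  · exact absurd (Ideal.mem_of_dvd _ h1 hg) (hC _ hb0)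
  · exact h1

lemma exists_denom {F : Type u} [Field F] {L : Type u} [Field L] [Algebra F L] {σ ι : Type}
    [Finite ι] (x : σ → L) (hx : IntermediateField.adjoin F (Set.range x) = ⊤) (y : ι → L) :
    ∃ (v : MvPolynomial σ F) (w : ι → MvPolynomial σ F), aeval x v ≠ 0 ∧
      ∀ k, aeval x v * y k = aeval x (w k) := by
  classical
  cases nonempty_fintype ι
  have h1 : ∀ k, ∃ r s : MvPolynomial σ F, aeval x s ≠ 0 ∧ aeval x s * y k = aeval x r := by
    intro k
    have : y k ∈ IntermediateField.adjoin F (Set.range x) := hx ▸ IntermediateField.mem_top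
    obtain ⟨r, s, h⟩ := (IntermediateField.mem_adjoin_range_iff F x (y k)).1 this
    by_cases hs : aeval x s = 0
    · refine ⟨0, 1, by simp, ?_⟩
      rw [h, hs]; simp
    · refine ⟨r, s, hs, ?_⟩
      rw [h]; field_simp
  choose r s hs hr using h1
  refine ⟨∏ k, s k, fun k => r k * ∏ l ∈ Finset.univ.erase k, s l, ?_, fun k => ?_⟩
  · rw [map_prod]; exact Finset.prod_ne_zero_iff.2 fun k _ => hs k
  · rw [← Finset.mul_prod_erase _ _ (Finset.mem_univ k), map_mul, map_mul, ← hr k]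
    ring

lemma ker_mv {F : Type u} [Field F] {L : Type u} [Field L] [Algebra F L] {m : ℕ}
    (y : Fin m → L) (hy : IsTranscendenceBasis F y) (α : L) :
    ∃ g : MvPolynomial (Option (Fin m)) F, Irreducible g ∧
      RingHom.ker (aeval (fun k : Option (Fin m) => k.elim α y) :
        MvPolynomial (Option (Fin m)) F →ₐ[F] L) = Ideal.span {g} := by
  let : Algebra (MvPolynomial (Fin m) F) L := (aeval y : _ →ₐ[F] L).toRingHom.toAlgebra
  have hinj : Function.Injective (algebraMap (MvPolynomial (Fin m) F) L) := hy.1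
  let e := optionEquivLeft F (Fin m)
  have he : ∀ f, aeval (fun k : Option (Fin m) => k.elim α y) f =
      Polynomial.aeval (R := MvPolynomial (Fin m) F) α (e f) := by
    intro f
    induction f using MvPolynomial.induction_on with
    | C a =>
      simp only [e, optionEquivLeft_C, Polynomial.aeval_C, algHom_C]
      exact (algHom_C (aeval y) a).symm
    | add f g hf hg => rw [map_add, map_add, map_add, hf, hg]
    | mul_X f j hf =>
      rw [map_mul, map_mul, map_mul, hf, aeval_X]
      congr 1
      cases j with
      | none => simp [e, optionEquivLeft_X_none]
      | some j =>
        simp only [e, optionEquivLeft_X_some, Polynomial.aeval_C, Option.elim_some]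
        exact (aeval_X y j).symm
  have hne : RingHom.ker (Polynomial.aeval α : Polynomial (MvPolynomial (Fin m) F) →ₐ[_] L) ≠ ⊥ := by
    have h1 := hy.isAlgebraic
    have h2 : IsAlgebraic (Algebra.adjoin F (Set.range y)) α := h1.1 α
    rw [Ne, RingHom.ker_eq_bot_iff_eq_zero]
    intro h3
    obtain ⟨q, hq0, hq⟩ := h2
    let ψ := hy.1.aevalEquiv
    apply hq0
    have h4 : (Polynomial.map (ψ.symm : _ →+* MvPolynomial (Fin m) F) q) = 0 := by
      apply h3
      rw [Polynomial.aeval_def, Polynomial.eval₂_map]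
      rw [Polynomial.aeval_def] at hq
      rw [← hq]
      congr 1
      ext z
      obtain ⟨z, rfl⟩ := ψ.surjective z
      simp only [RingHom.comp_apply, RingHom.coe_coe, AlgEquiv.symm_apply_apply]
      exact (hy.1.algebraMap_aevalEquiv z).symm
    rwa [Polynomial.map_eq_zero_iff] at h4
    exact ψ.symm.injective
  obtain ⟨g, hg, hk⟩ := ker_poly hinj α hne
  refine ⟨e.symm g, (MulEquiv.irreducible_iff e.symm).2 hg, ?_⟩
  ext f
  rw [RingHom.mem_ker, he, Ideal.mem_span_singleton]
  have : e f ∈ RingHom.ker (Polynomial.aeval α : Polynomial (MvPolynomial (Fin m) F) →ₐ[_] L) ↔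
      g ∣ e f := by rw [hk, Ideal.mem_span_singleton]
  rw [RingHom.mem_ker] at this
  rw [this, ← map_dvd_iff e, AlgEquiv.apply_symm_apply]

lemma exists_hyper {F : Type u} [Field F] [PerfectField F] {σ : Type} [Finite σ]
    (Q : Ideal (MvPolynomial σ F)) [Q.IsPrime] :
    ∃ (L : Type u) (_ : Field L) (_ : Algebra F L) (x : σ → L) (m : ℕ)
      (y : Option (Fin m) → L) (g : MvPolynomial (Option (Fin m)) F)
      (v : MvPolynomial σ F) (r : Option (Fin m) → MvPolynomial σ F)
      (s : MvPolynomial (Option (Fin m)) F) (p : σ → MvPolynomial (Option (Fin m)) F),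
      RingHom.ker (aeval x : MvPolynomial σ F →ₐ[F] L) = Q ∧ Irreducible g ∧
      RingHom.ker (aeval y : MvPolynomial _ F →ₐ[F] L) = Ideal.span {g} ∧
      aeval x v ≠ 0 ∧ (∀ k, aeval x v * y k = aeval x (r k)) ∧
      aeval y s ≠ 0 ∧ (∀ j, aeval y s * x j = aeval y (p j)) := by
  classical
  let B := MvPolynomial σ F ⧸ Q
  let L := FractionRing B
  let x : σ → L := fun j => algebraMap B L (Ideal.Quotient.mk Q (X j))
  have hx : ∀ f, aeval x f = algebraMap B L (Ideal.Quotient.mk Q f) := by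
    intro f
    have : (aeval x : MvPolynomial σ F →ₐ[F] L) =
        (IsScalarTower.toAlgHom F B L).comp (Ideal.Quotient.mkₐ F Q) := by
      ext j
      simp [x]
      rfl
    rw [this]; rfl
  have hker : RingHom.ker (aeval x : MvPolynomial σ F →ₐ[F] L) = Q := by
    ext f
    rw [RingHom.mem_ker, hx, map_eq_zero_iff _ (IsFractionRing.injective B L),
      Ideal.Quotient.eq_zero_iff_mem]
  have hadx : IntermediateField.adjoin F (Set.range x) = ⊤ := by
    rw [eq_top_iff]
    intro z _
    obtain ⟨a, b, hb, rfl⟩ := IsFractionRing.div_surjective (A := B) z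
    obtain ⟨a, rfl⟩ := Ideal.Quotient.mk_surjective a
    obtain ⟨b, rfl⟩ := Ideal.Quotient.mk_surjective b
    rw [IntermediateField.mem_adjoin_range_iff]
    exact ⟨a, b, by rw [hx, hx]⟩
  have : Algebra.EssFiniteType F L := inferInstance
  obtain ⟨t, ht, hsep⟩ := exists_isTranscendenceBasis_and_isSeparable_of_perfectField F L
  have : Algebra.EssFiniteType (IntermediateField.adjoin F (t : Set L)) L := .of_comp F _ _
  have : Module.Finite (IntermediateField.adjoin F (t : Set L)) L :=
    Algebra.finite_of_essFiniteType_of_isAlgebraic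
  obtain ⟨α, hα⟩ := Field.exists_primitive_element (IntermediateField.adjoin F (t : Set L)) L
  let y0 : Fin t.card → L := fun k => (t.equivFin.symm k : L)
  have hy0 : IsTranscendenceBasis F y0 := ht.comp_equiv t.equivFin.symm
  obtain ⟨g, hg, hgk⟩ := ker_mv y0 hy0 α
  have hady : IntermediateField.adjoin F
      (Set.range (fun k : Option (Fin t.card) => k.elim α y0)) = ⊤ := by
    have : Set.range (fun k : Option (Fin t.card) => k.elim α y0) = (t : Set L) ∪ {α} := by
      ext z
      simp only [Set.mem_range, Set.mem_union, Set.mem_singleton_iff, Finset.mem_coe]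
      constructor
      · rintro ⟨_ | k, rfl⟩
        · exact Or.inr rfl
        · exact Or.inl (t.equivFin.symm k).2
      · rintro (h | rfl)
        · exact ⟨some (t.equivFin ⟨z, h⟩), by simp [y0]⟩
        · exact ⟨none, rfl⟩
    rw [this, ← IntermediateField.adjoin_adjoin_left, hα, IntermediateField.restrictScalars_top]
  obtain ⟨v, r, hv, hr⟩ := exists_denom x hadx (fun k : Option (Fin t.card) => k.elim α y0)
  obtain ⟨s, p, hs, hp⟩ := exists_denom _ hady x
  exact ⟨L, inferInstance, inferInstance, x, t.card, _, g, v, r, s, p, hker, hg, hgk, hv, hr,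
    hs, hp⟩

end hyper

end Seid

namespace Seid

open MvPolynomial

section prime

lemma exists_prime {F : Type u} [Field F] [IsAlgClosed F] {σ : Type} [Finite σ]
    (Q : Ideal (MvPolynomial σ F)) [Q.IsPrime] :
    ∃ T : Finset F, ∀ A : Subring F, (T : Set F) ⊆ A →
      ∀ (E : Type u) [Field E] (φ : A →+* E), (sp A φ Q).IsPrime := by
  classical
  obtain ⟨L, _, _, x, m, y, g, v, r, s, p, hker, hg, hgk, hv, hr, hs, hp⟩ := exists_hyper Q
  have memQ : ∀ f, f ∈ Q ↔ aeval x f = 0 := fun f => by rw [← hker]; rfl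
  have memg : ∀ f, f ∈ Ideal.span {g} ↔ aeval y f = 0 := fun f => by rw [← hgk]; rfl
  have hgprime : (Ideal.span {g}).IsPrime := by rw [← hgk]; exact RingHom.ker_isPrime _
  obtain ⟨M, w, hMw⟩ := exists_homog.{u, u} s r v
  have hw : aeval x w = aeval x v ^ M * aeval y s := by
    have := hMw L (aeval x : MvPolynomial σ F →ₐ[F] L).toRingHom y hr
    rw [aeval_def y s]
    convert! this using 3
    ext a
    simp
  have hw0 : aeval x w ≠ 0 := by rw [hw]; exact mul_ne_zero (pow_ne_zero _ hv) hs
  obtain ⟨T1, h1⟩ := exists_coeffs r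
  obtain ⟨T2, h2⟩ := exists_coeffs p
  obtain ⟨T3, h3⟩ := exists_coeffs (fun _ : Unit => g)
  obtain ⟨T4, h4⟩ := exists_coeffs (Sum.elim (fun _ : Unit => v) (fun _ : Unit => w))
  obtain ⟨T5, h5⟩ := exists_coeffs_one s
  obtain ⟨T6, h6⟩ := exists_gen (fun _ : Unit => g)
  obtain ⟨T7, h7⟩ := exists_irred g hg
  obtain ⟨T8, h8⟩ := exists_sat (Ideal.span {g}) s (fun h => hs ((memg s).1 h))
  obtain ⟨T9, h9⟩ := exists_sat Q v (fun h => hv ((memQ v).1 h))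
  obtain ⟨T10, h10⟩ := exists_sat Q w (fun h => hw0 ((memQ w).1 h))
  refine ⟨T1 ∪ T2 ∪ T3 ∪ T4 ∪ T5 ∪ T6 ∪ T7 ∪ T8 ∪ T9 ∪ T10, fun A hA E _ φ => ?_⟩
  simp only [Finset.coe_union, Set.union_subset_iff] at hA
  obtain ⟨⟨⟨⟨⟨⟨⟨⟨⟨a1, a2⟩, a3⟩, a4⟩, a5⟩, a6⟩, a7⟩, a8⟩, a9⟩, a10⟩ := hA
  choose r' hr' using h1 A a1
  choose p' hp' using h2 A a2
  obtain ⟨g', hg'⟩ := h3 A a3 ()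
  obtain ⟨v', hv'⟩ := h4 A a4 (Sum.inl ())
  obtain ⟨w', hw'⟩ := h4 A a4 (Sum.inr ())
  obtain ⟨s', hs'⟩ := h5 A a5
  simp only [Sum.elim_inl, Sum.elim_inr] at hv' hw' hg'
  have hspg : sp A φ (Ideal.span {g}) = Ideal.span {MvPolynomial.map φ g'} := by
    have := sp_span_eq (h6 A a6 (fun _ => g') (fun _ => hg')) φ
    simpa using this
  have hgirr : Irreducible (MvPolynomial.map φ g') := h7 A a7 E φ g' hg'
  have hsg : MvPolynomial.map φ s' ∉ Ideal.span {MvPolynomial.map φ g'} := by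
    intro h
    have := h8 A a8 E φ s' hs' 1 (by rw [hspg, mul_one]; exact h)
    rw [hspg, Ideal.mem_span_singleton] at this
    exact hgirr.not_isUnit (isUnit_of_dvd_one this)
  have hvsat := h9 A a9 E φ v' hv'
  have hwsat := h10 A a10 E φ w' hw'
  have hpr : (Ideal.span {MvPolynomial.map φ g'}).IsPrime :=
    (Ideal.span_singleton_prime hgirr.ne_zero).2 hgirr.prime
  -- the generic point
  let B := MvPolynomial (Option (Fin m)) E ⧸ Ideal.span {MvPolynomial.map φ g'}
  let R' := FractionRing B
  let χ' : MvPolynomial (Option (Fin m)) E →+* R' :=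
    (algebraMap B R').comp (Ideal.Quotient.mk _)
  have hχ' : ∀ f, χ' f = 0 ↔ f ∈ Ideal.span {MvPolynomial.map φ g'} := by
    intro f
    simp only [χ', RingHom.comp_apply]
    rw [map_eq_zero_iff _ (IsFractionRing.injective B R'), Ideal.Quotient.eq_zero_iff_mem]
  have hs0 : χ' (MvPolynomial.map φ s') ≠ 0 := fun h => hsg ((hχ' _).1 h)
  let x' : σ → R' := fun j => χ' (MvPolynomial.map φ (p' j)) / χ' (MvPolynomial.map φ s')
  have hx' : ∀ j, χ' (MvPolynomial.map φ s') * x' j = χ' (MvPolynomial.map φ (p' j)) := by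
    intro j
    simp only [x']
    rw [mul_comm]
    exact div_mul_cancel₀ _ hs0
  let η : MvPolynomial σ E →+* R' := eval₂Hom (χ'.comp C) x'
  suffices h : sp A φ Q = RingHom.ker η by rw [h]; exact RingHom.ker_isPrime _
  apply le_antisymm
  · unfold sp
    rw [Ideal.map_le_iff_le_comap]
    intro f hf
    rw [mem_idA, memQ] at hf
    rw [Ideal.mem_comap, RingHom.mem_ker]
    obtain ⟨N, q, hq⟩ := exists_homog.{u, u} f p' s'
    have e1 := hq L ((aeval y : _ →ₐ[F] L).toRingHom.comp (MvPolynomial.map A.subtype)) x (by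
      intro j
      simp only [RingHom.comp_apply, hs', hp']
      exact hp j)
    have e2 : aeval y (MvPolynomial.map A.subtype q) = 0 := by
      refine Eq.trans e1 ?_
      rw [mul_eq_zero]; right
      rw [← hf, aeval_def, eval₂_map]
      congr 1
      ext a
      simp
    rw [← memg] at e2
    have e3 := map_mem_sp φ e2
    rw [hspg, ← hχ'] at e3
    have e4 := hq R' (χ'.comp (MvPolynomial.map φ)) x' (by
      intro j
      simp only [RingHom.comp_apply]
      exact hx' j)
    rw [RingHom.comp_apply, e3] at e4
    have e5 := (mul_eq_zero.1 e4.symm).resolve_left (pow_ne_zero _ hs0)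
    rw [← e5]
    simp only [η, coe_eval₂Hom, eval₂_map]
    congr 1
    ext a
    simp
  · intro f hf
    let D := MvPolynomial σ E ⧸ sp A φ Q
    let R := FractionRing D
    let π : MvPolynomial σ E →+* R := (algebraMap D R).comp (Ideal.Quotient.mk _)
    have hπ : ∀ f, π f = 0 ↔ f ∈ sp A φ Q := by
      intro f
      simp only [π, RingHom.comp_apply]
      rw [map_eq_zero_iff _ (IsFractionRing.injective D R), Ideal.Quotient.eq_zero_iff_mem]
    have hunit : ∀ z : MvPolynomial σ E, (∀ f, z * f ∈ sp A φ Q → f ∈ sp A φ Q) →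
        IsUnit (π z) := by
      intro z hz
      have : Ideal.Quotient.mk (sp A φ Q) z ∈ nonZeroDivisors D := by
        rw [mem_nonZeroDivisors_iff_right]
        intro b hb
        obtain ⟨b, rfl⟩ := Ideal.Quotient.mk_surjective b
        rw [← map_mul, Ideal.Quotient.eq_zero_iff_mem, mul_comm] at hb
        exact Ideal.Quotient.eq_zero_iff_mem.2 (hz b hb)
      exact IsLocalization.map_units R ⟨_, this⟩
    have uv := hunit _ hvsat
    have uw := hunit _ hwsat
    obtain ⟨vi, hvi⟩ := uv.exists_right_inv
    let yR : Option (Fin m) → R := fun k => vi * π (MvPolynomial.map φ (r' k))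
    let xR : σ → R := fun j => π (X j)
    let ρ : A →+* R := (π.comp C).comp φ
    let θL : MvPolynomial (Option (Fin m) ⊕ σ) A →+* L :=
      eval₂Hom ((algebraMap F L).comp A.subtype) (Sum.elim y x)
    let θR : MvPolynomial (Option (Fin m) ⊕ σ) A →+* R := eval₂Hom ρ (Sum.elim yR xR)
    have key : ∀ h, θL h = 0 → θR h = 0 := by
      intro h hh
      obtain ⟨N, q, hq⟩ := exists_homog.{u, u} h (Sum.elim r' (fun j => v' * X j)) v'
      have e1 := hq L ((aeval x : _ →ₐ[F] L).toRingHom.comp (MvPolynomial.map A.subtype))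
        (Sum.elim y x) (by
          rintro (k | j)
          · simp only [RingHom.comp_apply, hv', hr', Sum.elim_inl]
            exact hr k
          · simp only [RingHom.comp_apply, hv', Sum.elim_inr, map_mul]
            simp)
      have e2 : aeval x (MvPolynomial.map A.subtype q) = 0 := by
        refine Eq.trans e1 ?_
        rw [mul_eq_zero]; right
        rw [← hh]
        simp only [θL, coe_eval₂Hom]
        congr 1
        ext a
        simp
      rw [← memQ] at e2
      have e3 := map_mem_sp φ e2
      rw [← hπ] at e3
      have e4 := hq R (π.comp (MvPolynomial.map φ)) (Sum.elim yR xR) (by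
        rintro (k | j)
        · simp only [RingHom.comp_apply, Sum.elim_inl, yR]
          rw [← mul_assoc, hvi, one_mul]
        · simp only [RingHom.comp_apply, Sum.elim_inr, map_mul, map_X, xR])
      rw [RingHom.comp_apply, e3] at e4
      have e5 := ((uv.pow N).mul_right_eq_zero).1 e4.symm
      rw [← e5]
      simp only [θR, coe_eval₂Hom]
      congr 1
      ext a
      simp [ρ]
    let χ : MvPolynomial (Option (Fin m)) E →+* R := eval₂Hom (π.comp C) yR
    have Ly : ∀ h, θL (rename Sum.inl h) = aeval y (MvPolynomial.map A.subtype h) := by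
      intro h
      simp only [θL, coe_eval₂Hom, eval₂_rename, aeval_def, eval₂_map, Sum.elim_comp_inl]
    have Lx : ∀ h, θL (rename Sum.inr h) = aeval x (MvPolynomial.map A.subtype h) := by
      intro h
      simp only [θL, coe_eval₂Hom, eval₂_rename, aeval_def, eval₂_map, Sum.elim_comp_inr]
    have Ry : ∀ h, θR (rename Sum.inl h) = χ (MvPolynomial.map φ h) := by
      intro h
      simp only [θR, χ, ρ, coe_eval₂Hom, eval₂_rename, eval₂_map, Sum.elim_comp_inl]
    have hπe : ∀ f, eval₂ (π.comp C) xR f = π f := by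
      intro f
      have : eval₂Hom (π.comp C) xR = π := by
        ext a
        · simp
        · simp [xR]
      exact congrArg (fun t : MvPolynomial σ E →+* R => t f) this
    have Rx : ∀ h, θR (rename Sum.inr h) = π (MvPolynomial.map φ h) := by
      intro h
      simp only [θR, ρ, coe_eval₂Hom, eval₂_rename, Sum.elim_comp_inr]
      rw [← eval₂_map, hπe]
    have k1 : χ (MvPolynomial.map φ g') = 0 := by
      rw [← Ry]
      apply key
      rw [Ly, hg', ← memg]
      exact Ideal.mem_span_singleton_self g
    have k2 : ∀ j, χ (MvPolynomial.map φ s') * xR j = χ (MvPolynomial.map φ (p' j)) := by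
      intro j
      have := key (rename Sum.inl s' * rename Sum.inr (X j) - rename Sum.inl (p' j)) (by
        rw [map_sub, map_mul, Ly, Ly, Lx, hs', hp', map_X, aeval_X, hp, sub_self])
      rw [map_sub, map_mul, Ry, Ry, Rx, map_X] at this
      exact sub_eq_zero.1 this
    have k3 : π (MvPolynomial.map φ v') ^ M * χ (MvPolynomial.map φ s') =
        π (MvPolynomial.map φ w') := by
      have := key (rename Sum.inr v' ^ M * rename Sum.inl s' - rename Sum.inr w') (by
        rw [map_sub, map_mul, map_pow, Ly, Lx, Lx, hs', hv', hw', hw, sub_self])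
      rw [map_sub, map_mul, map_pow, Ry, Rx, Rx] at this
      exact sub_eq_zero.1 this
    have us : IsUnit (χ (MvPolynomial.map φ s')) := by
      rw [← k3] at uw
      exact isUnit_of_mul_isUnit_right uw
    obtain ⟨N, q, hq⟩ := exists_homog.{u, u} f (fun j => MvPolynomial.map φ (p' j))
      (MvPolynomial.map φ s')
    have e1 := hq R' χ' x' hx'
    rw [RingHom.mem_ker] at hf
    have hf' : eval₂ (χ'.comp C) x' f = 0 := hf
    rw [hf', mul_zero, hχ', Ideal.mem_span_singleton] at e1
    obtain ⟨q', rfl⟩ := e1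
    have e2 := hq R χ xR k2
    rw [map_mul, k1, zero_mul] at e2
    have e3 := ((us.pow N).mul_right_eq_zero).1 e2.symm
    have hχC : χ.comp C = π.comp C := by
      ext a
      simp [χ]
    rw [hχC, hπe, hπ] at e3
    exact e3

end prime

end Seid

namespace Seid

open MvPolynomial

section limit

variable {F : ℕ → Type u} [∀ C, Field (F C)]

lemma exists_limit (F : ℕ → Type u) [∀ C, Field (F C)] :
    ∃ m : Ideal (∀ C, F C), m.IsMaximal ∧
      ∀ z : ∀ C, F C, (∃ D, ∀ C ≥ D, z C = 0) → z ∈ m := by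
  let J : Ideal (∀ C, F C) :=
    { carrier := {z | ∃ D, ∀ C ≥ D, z C = 0}
      add_mem' := by
        rintro a b ⟨D1, h1⟩ ⟨D2, h2⟩
        refine ⟨max D1 D2, fun C hC => ?_⟩
        rw [Pi.add_apply, h1 C (le_of_max_le_left hC), h2 C (le_of_max_le_right hC), add_zero]
      zero_mem' := ⟨0, fun _ _ => rfl⟩
      smul_mem' := by
        rintro c a ⟨D, h⟩
        refine ⟨D, fun C hC => ?_⟩
        rw [smul_eq_mul, Pi.mul_apply, h C hC, mul_zero] }
  have hJ : J ≠ ⊤ := by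
    rw [Ne, Ideal.eq_top_iff_one]
    rintro ⟨D, h⟩
    exact one_ne_zero (h D le_rfl)
  obtain ⟨m, hm, hle⟩ := Ideal.exists_le_maximal J hJ
  exact ⟨m, hm, fun z hz => hle hz⟩

lemma limit_closed [∀ C, IsAlgClosed (F C)] (m : Ideal (∀ C, F C)) (K : Type u) [Field K]
    (μ : (∀ C, F C) →+* K) (hμ : Function.Surjective μ) : IsAlgClosed K := by
  apply IsAlgClosed.of_exists_root
  intro p hp hirr
  have hl : p ∈ Polynomial.lifts μ := by
    rw [Polynomial.lifts_iff_coeff_lifts]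
    intro n
    exact hμ _
  obtain ⟨q, hq, hqd, hqm⟩ := Polynomial.lifts_and_natDegree_eq_and_monic hl hp
  have hr : ∀ C, ∃ x : F C, (q.map (Pi.evalRingHom F C)).eval x = 0 := by
    intro C
    apply IsAlgClosed.exists_root
    have := hirr.natDegree_pos
    intro h
    have h2 := Polynomial.natDegree_eq_of_degree_eq_some h
    rw [hqm.natDegree_map, hqd] at h2
    exact this.ne' h2
  choose z hz using hr
  refine ⟨μ z, ?_⟩
  have : q.eval z = 0 := by
    funext C
    have h := hz C
    rw [Polynomial.eval_map] at h
    have h3 := Polynomial.eval₂_at_apply (p := q) (Pi.evalRingHom F C) z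
    exact h3.symm.trans h
  rw [← hq, Polynomial.eval_map, Polynomial.eval₂_at_apply, this, map_zero]

lemma limit_lift (K : Type u) [Field K] (μ : (∀ C, F C) →+* K)
    (hev : ∀ z : ∀ C, F C, (∃ D, ∀ C ≥ D, z C = 0) → μ z = 0)
    {κ : Type u} [Finite κ] (z : κ → ∀ C, F C) :
    ∃ A : Subring K, (∀ k, μ (z k) ∈ A) ∧ ∀ D : ℕ, ∃ C ≥ D, ∃ φ : A →+* F C,
      ∀ k (h : μ (z k) ∈ A), φ ⟨μ (z k), h⟩ = z k C := by
  classical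
  let ε : MvPolynomial κ ℤ →+* (∀ C, F C) := eval₂Hom (Int.castRingHom _) z
  have hε : ∀ k, ε (X k) = z k := fun k => by simp [ε]
  refine ⟨(μ.comp ε).range, fun k => ⟨X k, by rw [RingHom.comp_apply, hε]⟩, fun D => ?_⟩
  obtain ⟨G, hG⟩ := (isNoetherianRing_iff_ideal_fg _).1 inferInstance (RingHom.ker (μ.comp ε))
  have hC : ∃ C ≥ D, ∀ g ∈ G, ε g C = 0 := by
    by_contra hcon
    push Not at hcon
    have hch : ∀ C, ∃ g : MvPolynomial κ ℤ, D ≤ C → g ∈ G ∧ ε g C ≠ 0 := by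
      intro C
      by_cases h : D ≤ C
      · obtain ⟨g, hg⟩ := hcon C h
        exact ⟨g, fun _ => hg⟩
      · exact ⟨0, fun h' => absurd h' h⟩
    choose γ hγ using hch
    let e : MvPolynomial κ ℤ → ∀ C, F C := fun g C => if g = γ C then (ε g C)⁻¹ else 0
    have h1 : μ (1 - ∑ g ∈ G, e g * ε g) = 0 := by
      apply hev
      refine ⟨D, fun C hC => ?_⟩
      rw [Pi.sub_apply, Finset.sum_apply, Pi.one_apply, Finset.sum_eq_single (γ C)]
      · simp only [e, Pi.mul_apply, if_true]
        rw [inv_mul_cancel₀ (hγ C hC).2, sub_self]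
      · intro g _ hne
        simp [e, hne]
      · intro h
        exact absurd (hγ C hC).1 h
    rw [map_sub, map_one, map_sum, Finset.sum_eq_zero, sub_zero] at h1
    · exact one_ne_zero h1
    · intro g hg
      have : g ∈ RingHom.ker (μ.comp ε) := hG ▸ Ideal.subset_span hg
      rw [RingHom.mem_ker, RingHom.comp_apply] at this
      rw [map_mul, this, mul_zero]
  obtain ⟨C, hCD, hC⟩ := hC
  refine ⟨C, hCD, ?_⟩
  have hle : RingHom.ker (μ.comp ε).rangeRestrict ≤ RingHom.ker ((Pi.evalRingHom F C).comp ε) := by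
    rw [RingHom.ker_rangeRestrict, ← hG, Ideal.span_le]
    intro g hg
    exact hC g hg
  let φ := RingHom.liftOfSurjective (μ.comp ε).rangeRestrict
    (μ.comp ε).rangeRestrict_surjective ⟨_, hle⟩
  refine ⟨φ, fun k h => ?_⟩
  have : (⟨μ (z k), h⟩ : (μ.comp ε).range) = (μ.comp ε).rangeRestrict (X k) := by
    apply Subtype.ext
    rw [RingHom.coe_rangeRestrict, RingHom.comp_apply, hε]
  rw [this]
  refine (RingHom.liftOfRightInverse_comp_apply _ _ _ _ _).trans ?_
  simp [hε]

lemma exists_inf_finset {F : Type u} [Field F] {σ : Type} [Finite σ]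
    (s : Finset (Ideal (MvPolynomial σ F))) :
    ∃ T : Finset F, ∀ A : Subring F, (T : Set F) ⊆ A →
      ∀ (E : Type u) [Field E] (φ : A →+* E), s.inf (sp A φ) = sp A φ (s.inf id) := by
  classical
  induction s using Finset.induction_on with
  | empty => exact ⟨∅, fun A _ E _ φ => by simp [sp_top]⟩
  | insert P s _ ih =>
    obtain ⟨T1, h1⟩ := ih
    obtain ⟨T2, h2⟩ := exists_inf P (s.inf id)
    refine ⟨T1 ∪ T2, fun A hA E _ φ => ?_⟩
    rw [Finset.coe_union, Set.union_subset_iff] at hA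
    rw [Finset.inf_insert, Finset.inf_insert, h1 A hA.1, id, h2 A hA.2]

/-- The conclusion of the theorem with bound `C`. -/
def Good {F : Type u} [Field F] {σ : Type} (C : ℕ) (I : Ideal (MvPolynomial σ F)) : Prop :=
  (∃ S : Set (MvPolynomial σ F), (∀ f ∈ S, f.totalDegree ≤ C) ∧ Ideal.span S = I.radical) ∧
  (I.minimalPrimes.Finite ∧ Nat.card I.minimalPrimes ≤ C) ∧
  (∀ P ∈ I.minimalPrimes, ∃ S : Set (MvPolynomial σ F),
    (∀ f ∈ S, f.totalDegree ≤ C) ∧ Ideal.span S = P)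

lemma exists_good {K : Type u} [Field K] [IsAlgClosed K] {σ : Type} [Finite σ]
    (I : Ideal (MvPolynomial σ K)) :
    ∃ (T : Finset K) (D : ℕ), ∀ A : Subring K, (T : Set K) ⊆ A →
      ∀ (E : Type u) [Field E] (φ : A →+* E), ∀ C ≥ D, Good C (sp A φ I) := by
  classical
  have hfin := Ideal.finite_minimalPrimes_of_isNoetherianRing (MvPolynomial σ K) I
  let s := hfin.toFinset
  have hs : ∀ P, P ∈ s ↔ P ∈ I.minimalPrimes := fun P => hfin.mem_toFinset
  have hinf : s.inf id = I.radical := by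
    rw [← Ideal.sInf_minimalPrimes, Finset.inf_id_eq_sInf, hfin.coe_toFinset]
  have hprime : ∀ P : Ideal (MvPolynomial σ K), ∃ T : Finset K, P ∈ s →
      ∀ A : Subring K, (T : Set K) ⊆ A →
      ∀ (E : Type u) [Field E] (φ : A →+* E), (sp A φ P).IsPrime := by
    intro P
    by_cases hP : P ∈ s
    · have := ((hs P).1 hP).1.1
      obtain ⟨T, hT⟩ := exists_prime P
      exact ⟨T, fun _ => hT⟩
    · exact ⟨∅, fun h => absurd h hP⟩
  choose TP hTP using hprime
  choose TD DD hD using fun P : Ideal (MvPolynomial σ K) => exists_degree_bound P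
  obtain ⟨TI, hTI⟩ := exists_inf_finset s
  refine ⟨s.biUnion TP ∪ s.biUnion TD ∪ TD I.radical ∪ TI,
    s.card + s.sup DD + DD I.radical, fun A hA E _ φ C hC => ?_⟩
  simp only [Finset.coe_union, Set.union_subset_iff] at hA
  obtain ⟨⟨⟨a1, a2⟩, a3⟩, a4⟩ := hA
  have b1 : ∀ P ∈ s, (TP P : Set K) ⊆ A := fun P hP =>
    (Finset.coe_subset.2 (Finset.subset_biUnion_of_mem TP hP)).trans a1
  have b2 : ∀ P ∈ s, (TD P : Set K) ⊆ A := fun P hP =>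
    (Finset.coe_subset.2 (Finset.subset_biUnion_of_mem TD hP)).trans a2
  have hJ := hTI A a4 E φ
  rw [hinf] at hJ
  have hpr : ∀ P ∈ s, (sp A φ P).IsPrime := fun P hP => hTP P hP A (b1 P hP) E φ
  have hrad : (sp A φ I).radical = sp A φ I.radical := by
    apply le_antisymm
    · have h1 : (sp A φ I.radical).IsRadical := by
        rw [← hJ]
        intro f hf
        rw [Ideal.mem_radical_iff] at hf
        obtain ⟨n, hn⟩ := hf
        rw [Submodule.mem_finsetInf] at hn ⊢
        intro P hP
        exact (hpr P hP).mem_of_pow_mem n (hn P hP)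
      rw [h1.radical_le_iff]
      exact sp_mono φ Ideal.le_radical
    · obtain ⟨k, hk⟩ := Ideal.exists_radical_pow_le_of_fg I
        ((isNoetherianRing_iff_ideal_fg _).1 inferInstance _)
      intro f hf
      refine ⟨k, ?_⟩
      exact ((sp_pow_le φ _ k).trans (sp_mono φ hk)) (Ideal.pow_mem_pow hf k)
  have hmin : ∀ P ∈ (sp A φ I).minimalPrimes, ∃ P' ∈ s, sp A φ P' = P := by
    intro P hP
    have hPp : P.IsPrime := hP.1.1
    have h1 : s.inf (sp A φ) ≤ P := by
      rw [hJ, ← hrad, hPp.radical_le_iff]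
      exact hP.1.2
    obtain ⟨P', hP', hle⟩ := hPp.inf_le'.1 h1
    refine ⟨P', hP', le_antisymm hle ?_⟩
    exact hP.2 ⟨hpr P' hP', sp_mono φ ((hs P').1 hP').1.2⟩ hle
  have hsub : (sp A φ I).minimalPrimes ⊆ (s.image (sp A φ) : Finset _) := by
    intro P hP
    obtain ⟨P', h1, h2⟩ := hmin P hP
    exact Finset.mem_coe.2 (Finset.mem_image.2 ⟨P', h1, h2⟩)
  refine ⟨?_, ⟨(Finset.finite_toSet _).subset hsub, ?_⟩, ?_⟩
  · obtain ⟨S, h1, h2⟩ := hD I.radical A a3 E φ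
    exact ⟨S, fun f hf => (h1 f hf).trans (by omega), by rw [h2, hrad]⟩
  · have h1 := Set.ncard_le_ncard hsub (Finset.finite_toSet _)
    rw [Set.ncard_coe_finset] at h1
    have h2 := Finset.card_image_le (s := s) (f := sp A φ)
    rw [Nat.card_coe_set_eq]
    omega
  · intro P hP
    obtain ⟨P', hP', rfl⟩ := hmin P hP
    obtain ⟨S, h1, h2⟩ := hD P' A (b2 P' hP') E φ
    have h3 := Finset.le_sup (f := DD) hP'
    exact ⟨S, fun f hf => (h1 f hf).trans (by omega), h2⟩

lemma core (F : ℕ → Type u) [∀ C, Field (F C)] [∀ C, IsAlgClosed (F C)] {σ κ : Type}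
    [Finite σ] [Finite κ] (M : Finset (σ →₀ ℕ)) (f : ∀ C, κ → MvPolynomial σ (F C))
    (hf : ∀ C k, (f C k).support ⊆ M) :
    ∃ C, Good C (Ideal.span (Set.range (f C))) := by
  classical
  obtain ⟨m, hm, hev⟩ := exists_limit F
  let K := (∀ C, F C) ⧸ m
  let _ : Field K := Ideal.Quotient.field m
  let μ : (∀ C, F C) →+* K := Ideal.Quotient.mk m
  have hμ : Function.Surjective μ := Ideal.Quotient.mk_surjective
  have : IsAlgClosed K := limit_closed m K μ hμ
  let c : κ → (σ →₀ ℕ) → ∀ C, F C := fun k α C => coeff α (f C k)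
  let fK : κ → MvPolynomial σ K := fun k => ∑ α ∈ M, monomial α (μ (c k α))
  obtain ⟨T1, h1⟩ := exists_gen fK
  obtain ⟨T2, D, h2⟩ := exists_good (Ideal.span (Set.range fK))
  choose τ hτ using hμ
  let z : (↥(T1 ∪ T2) ⊕ ULift.{u} (κ × M)) → ∀ C, F C :=
    Sum.elim (fun t => τ t) (fun q => c q.down.1 q.down.2)
  obtain ⟨A, hA, hlift⟩ := limit_lift K μ
    (fun z hz => Ideal.Quotient.eq_zero_iff_mem.2 (hev z hz)) z
  have hTA : ((T1 ∪ T2 : Finset K) : Set K) ⊆ A := by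
    intro t ht
    have := hA (Sum.inl ⟨t, ht⟩)
    simp only [z, Sum.elim_inl, hτ] at this
    exact this
  rw [Finset.coe_union, Set.union_subset_iff] at hTA
  have hcA : ∀ k (α : M), μ (c k α) ∈ A := fun k α => hA (Sum.inr ⟨(k, α)⟩)
  let f' : κ → MvPolynomial σ A := fun k => ∑ α : M, monomial (α : σ →₀ ℕ) ⟨_, hcA k α⟩
  obtain ⟨C, hCD, φ, hφ⟩ := hlift D
  refine ⟨C, ?_⟩
  have e1 : ∀ k, MvPolynomial.map A.subtype (f' k) = fK k := by
    intro k
    simp only [f', fK, map_sum, map_monomial, Subring.subtype_apply]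
    rw [Finset.sum_coe_sort M (fun α => monomial α (μ (c k α)))]
  have e2 : ∀ k, MvPolynomial.map φ (f' k) = f C k := by
    intro k
    have : ∀ α : M, φ ⟨_, hcA k α⟩ = coeff (α : σ →₀ ℕ) (f C k) := fun α =>
      hφ (Sum.inr ⟨(k, α)⟩) (hcA k α)
    simp only [f', map_sum, map_monomial, this]
    rw [Finset.sum_coe_sort M (fun α => monomial α (coeff α (f C k)))]
    conv_rhs => rw [(f C k).as_sum]
    symm
    apply Finset.sum_subset (hf C k)
    intro α _ h
    rw [notMem_support_iff.1 h, map_zero]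
  have e3 := sp_span_eq (h1 A hTA.1 f' e1) φ
  simp only [e2] at e3
  have := h2 A hTA.2 (F C) φ C hCD
  rwa [e3] at this

lemma exists_family {F : Type u} [Field F] {σ : Type} (d : ℕ) (M : Finset (σ →₀ ℕ))
    (hM : ∀ p : MvPolynomial σ F, p.totalDegree ≤ d → p.support ⊆ M)
    (I : Ideal (MvPolynomial σ F)) (S : Set (MvPolynomial σ F))
    (hS : ∀ f ∈ S, f.totalDegree ≤ d) (hI : Ideal.span S = I) :
    ∃ f : M → MvPolynomial σ F, (∀ k, (f k).support ⊆ M) ∧ Ideal.span (Set.range f) = I := by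
  classical
  let V : Submodule F (MvPolynomial σ F) := I.restrictScalars F ⊓ restrictTotalDegree σ F d
  obtain ⟨π, hπ⟩ := V.subtype.exists_leftInverse_of_injective V.ker_subtype
  have hV : ∀ v : V, (v : MvPolynomial σ F) ∈ I ∧ (v : MvPolynomial σ F).totalDegree ≤ d := by
    intro v
    exact ⟨v.2.1, (mem_restrictTotalDegree _ _ _).1 v.2.2⟩
  refine ⟨fun α => (π (monomial α 1) : V), fun k => hM _ (hV _).2, le_antisymm ?_ ?_⟩
  · rw [Ideal.span_le]
    rintro _ ⟨k, rfl⟩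
    exact (hV _).1
  · rw [← hI, Ideal.span_le]
    intro v hv
    have hvV : v ∈ V := ⟨hI ▸ Ideal.subset_span hv, (mem_restrictTotalDegree _ _ _).2 (hS v hv)⟩
    have h1 : π v = ⟨v, hvV⟩ := LinearMap.congr_fun hπ ⟨v, hvV⟩
    have h2 : v = (π v : V) := by rw [h1]
    rw [h2]
    have h3 : v = ∑ α ∈ v.support, coeff α v • monomial α (1 : F) := by
      conv_lhs => rw [v.as_sum]
      refine Finset.sum_congr rfl fun α _ => ?_
      rw [smul_monomial, smul_eq_mul, mul_one]
    rw [h3, map_sum, AddSubmonoidClass.coe_finsetSum]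
    refine Ideal.sum_mem _ fun α hα => ?_
    rw [map_smul, Submodule.coe_smul, smul_eq_C_mul]
    exact Ideal.mul_mem_left _ _ (Ideal.subset_span ⟨⟨α, hM v (hS v hv) hα⟩, rfl⟩)

lemma main (n d : ℕ) :
    ∃ C : ℕ, ∀ (F : Type u) [Field F] [IsAlgClosed F],
      ∀ I : Ideal (MvPolynomial (Fin n) F),
        (∃ S : Set (MvPolynomial (Fin n) F),
          (∀ f ∈ S, f.totalDegree ≤ d) ∧ Ideal.span S = I) → Good C I := by
  classical
  by_contra hcon
  push Not at hcon
  choose F i1 i2 I hI hbad using hcon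
  choose S hS hSI using hI
  let M : Finset (Fin n →₀ ℕ) := (Finsupp.finite_of_degree_le (σ := Fin n) d).toFinset
  have hM : ∀ {K : Type u} [Field K] (p : MvPolynomial (Fin n) K), p.totalDegree ≤ d →
      p.support ⊆ M := by
    intro K _ p hp a ha
    simp only [M, Set.Finite.mem_toFinset]
    exact (le_totalDegree ha).trans hp
  choose f hf1 hf2 using fun C => exists_family d M hM (I C) (S C) (hS C) (hSI C)
  obtain ⟨C, hC⟩ := core F M f hf1
  rw [hf2 C] at hC
  exact hbad C hC

end limit

end Seid

/-- **Lemma (Seidenberg).**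
For all positive integers `n`, `d` there is a constant `C = C(n, d)` such that for every
algebraically closed field `F` and every ideal `I` of `F[X₁, …, X_n]` generated in degrees
`≤ d`: the radical `√I` is generated in degrees `≤ C`; the number of minimal primes over `I`
is at most `C`; and every minimal prime over `I` is generated in degrees `≤ C`. -/
theorem stmt_17 (n d : ℕ) (hn : 0 < n) (hd : 0 < d) :
    ∃ C : ℕ, ∀ (F : Type u) [Field F] [IsAlgClosed F],
      ∀ I : Ideal (MvPolynomial (Fin n) F),
        (∃ S : Set (MvPolynomial (Fin n) F),
          (∀ f ∈ S, f.totalDegree ≤ d) ∧ Ideal.span S = I) →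
        (∃ S : Set (MvPolynomial (Fin n) F),
          (∀ f ∈ S, f.totalDegree ≤ C) ∧ Ideal.span S = I.radical) ∧
        (I.minimalPrimes.Finite ∧ Nat.card I.minimalPrimes ≤ C) ∧
        (∀ P ∈ I.minimalPrimes, ∃ S : Set (MvPolynomial (Fin n) F),
          (∀ f ∈ S, f.totalDegree ≤ C) ∧ Ideal.span S = P) := by
  exact Seid.main n d
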